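/- Let a ∈ ℚ₂ with a ≠ 0, ‖a‖ = 1/4, and suppose there exists c ∈ ℚ₂ with a = 3·c². Set D₁ = closedBall(1/2, 1/2), D₂ = closedBall(-1/2, 1/2), D₃ = closedBall(8, 1/16), D₄ = closedBall(1/8, 4) in ℚ₂, and let Ω = D₁ ∪ D₂ ∪ D₃ ∪ D₄ (which equals S(0,2) ∪ S(0,8) ∪ S(0,1/8)). Then φ maps Ω into Ω, and there is a homeomorphism h : Ω ≃ₜ Σ_A with h(φ(x)) = σ(h(x)) for all x ∈ Ω, where A is the 4×4 matrix with rows (0,0,1,0), (0,0,1,0), (0,0,0,1), (1,1,0,0); moreover h can be chosen so that for all x ∈ Ω and n ∈ ℕ, the symbol h(x)(n) = j exactly when φ^[n](x) ∈ D_{j+1}. -/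

import Mathlib

open Metric Set

/-- The rational map `φ(x) = a·x + 1/x` on `ℚ₂` (with the convention `0⁻¹ = 0`). -/
noncomputable def phi (a : ℚ_[2]) (x : ℚ_[2]) : ℚ_[2] := a * x + x⁻¹

/-- The incidence matrix with rows `(0,0,1,0), (0,0,1,0), (0,0,0,1), (1,1,0,0)`. -/
def A14 : Fin 4 → Fin 4 → ℕ :=
  ![![0, 0, 1, 0], ![0, 0, 1, 0], ![0, 0, 0, 1], ![1, 1, 0, 0]]

/-- The subshift of finite type `Σ_A` determined by a 0–1 matrix `A` on `Fin 4`,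
with the topology induced from the product topology on `ℕ → Fin 4`. -/
def SigmaA14 (A : Fin 4 → Fin 4 → ℕ) : Type :=
  {s : ℕ → Fin 4 // ∀ n : ℕ, A (s n) (s (n + 1)) = 1}

instance : TopologicalSpace (SigmaA14 A14) :=
  inferInstanceAs (TopologicalSpace {s : ℕ → Fin 4 // ∀ n : ℕ, A14 (s n) (s (n + 1)) = 1})

/-- The four disks `D₁, D₂, D₃, D₄` of the repeller. -/
noncomputable def D14 : Fin 4 → Set ℚ_[2] :=
  ![closedBall (1 / 2 : ℚ_[2]) (1 / 2), closedBall (-(1 / 2) : ℚ_[2]) (1 / 2),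
    closedBall (8 : ℚ_[2]) (1 / 16), closedBall (1 / 8 : ℚ_[2]) 4]

/-- In an ultrametric field a strictly dominant summand determines the norm. -/
lemma norm_add_eq_left {x y : ℚ_[2]} (h : ‖y‖ < ‖x‖) : ‖x + y‖ = ‖x‖ := by
  rw [Padic.add_eq_max_of_ne h.ne', max_eq_left h.le]

lemma norm_sub_le_max (x y : ℚ_[2]) : ‖x - y‖ ≤ max ‖x‖ ‖y‖ := by
  simpa [sub_eq_add_neg] using IsUltrametricDist.norm_add_le_max x (-y)

lemma norm_two : ‖(2 : ℚ_[2])‖ = 1 / 2 := by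
  simpa using Padic.norm_p (p := 2)

/-- The residue field of `ℚ₂` has two elements, so any two units are congruent. -/
lemma norm_sub_one_le {x : ℚ_[2]} (h : ‖x‖ = 1) : ‖x - 1‖ ≤ 1 / 2 := by
  let u : ℤ_[2] := ⟨x, h.le⟩
  have hu : PadicInt.toZMod u ≠ 0 := by
    intro h0
    have hmem : u ∈ RingHom.ker (PadicInt.toZMod (p := 2)) := h0
    rw [PadicInt.ker_toZMod, IsLocalRing.mem_maximalIdeal, PadicInt.mem_nonunits] at hmem
    exact hmem.ne h
  have h1 : PadicInt.toZMod u = 1 := by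
    generalize PadicInt.toZMod u = z at hu
    revert z
    decide
  have hmem : u - 1 ∈ RingHom.ker (PadicInt.toZMod (p := 2)) := by
    simp [RingHom.mem_ker, h1]
  rw [PadicInt.ker_toZMod, PadicInt.maximalIdeal_eq_span_p, Ideal.mem_span_singleton] at hmem
  obtain ⟨k, hk⟩ := hmem
  have hk' : x - 1 = 2 * (k : ℚ_[2]) := by
    exact_mod_cast congrArg (fun z : ℤ_[2] => (z : ℚ_[2])) hk
  rw [hk', norm_mul, norm_two]
  have : ‖(k : ℚ_[2])‖ ≤ 1 := k.2
  linarith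

lemma norm_sub_le_half {x y : ℚ_[2]} (h : ‖x‖ = ‖y‖) : ‖x - y‖ ≤ ‖y‖ / 2 := by
  rcases eq_or_ne y 0 with rfl | hy
  · simp_all
  have h1 : ‖x / y - 1‖ ≤ 1 / 2 := by
    apply norm_sub_one_le
    rw [norm_div, h, div_self (norm_ne_zero_iff.2 hy)]
  have h2 : x - y = (x / y - 1) * y := by field_simp
  rw [h2, norm_mul]
  nlinarith [norm_nonneg y]

lemma norm_half : ‖(1 / 2 : ℚ_[2])‖ = 2 := by
  rw [norm_div, norm_two]; norm_num

lemma norm_four : ‖(4 : ℚ_[2])‖ = 1 / 4 := by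
  rw [show (4 : ℚ_[2]) = 2 * 2 by norm_num, norm_mul, norm_two]; norm_num

lemma norm_eight : ‖(8 : ℚ_[2])‖ = 1 / 8 := by
  rw [show (8 : ℚ_[2]) = 2 * 4 by norm_num, norm_mul, norm_two, norm_four]; norm_num

lemma norm_eighth : ‖(1 / 8 : ℚ_[2])‖ = 8 := by
  rw [norm_div, norm_eight]; norm_num

lemma norm_three : ‖(3 : ℚ_[2])‖ = 1 := by
  rw [show (3 : ℚ_[2]) = 1 + 2 by norm_num, norm_add_eq_left] <;> simp [norm_two]
  norm_num

lemma norm_lt_iff_le_half {x y : ℚ_[2]} (hy : y ≠ 0) : ‖x‖ < ‖y‖ ↔ ‖x‖ ≤ ‖y‖ / 2 := by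
  have hy' := norm_pos_iff.2 hy
  refine ⟨fun h => ?_, fun h => by linarith⟩
  have h1 : ‖x + y‖ = ‖y‖ := by rw [add_comm, norm_add_eq_left h]
  simpa using norm_sub_le_half h1

lemma mem_closedBall_iff_norm_eq {c x : ℚ_[2]} (hc : c ≠ 0) :
    x ∈ closedBall c (‖c‖ / 2) ↔ ‖x‖ = ‖c‖ := by
  rw [mem_closedBall, dist_eq_norm, ← norm_lt_iff_le_half hc]
  refine ⟨fun h => ?_, fun h => ?_⟩
  · rw [← norm_add_eq_left h]; congr 1; ring
  · exact (norm_lt_iff_le_half hc).2 (norm_sub_le_half h)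

lemma mem_D14_two {x : ℚ_[2]} : x ∈ D14 2 ↔ ‖x‖ = 1 / 8 := by
  rw [← norm_eight, ← mem_closedBall_iff_norm_eq (by norm_num), norm_eight,
    show (1 / 8 / 2 : ℝ) = 1 / 16 by norm_num]
  rfl

lemma mem_D14_three {x : ℚ_[2]} : x ∈ D14 3 ↔ ‖x‖ = 8 := by
  rw [← norm_eighth, ← mem_closedBall_iff_norm_eq (by norm_num), norm_eighth,
    show (8 / 2 : ℝ) = 4 by norm_num]
  rfl

lemma norm_of_mem_D14_zero {x : ℚ_[2]} (h : x ∈ D14 0) : ‖x‖ = 2 := by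
  rw [← norm_half, ← mem_closedBall_iff_norm_eq (by norm_num), norm_half]
  exact closedBall_subset_closedBall (by norm_num) h

lemma norm_of_mem_D14_one {x : ℚ_[2]} (h : x ∈ D14 1) : ‖x‖ = 2 := by
  rw [← norm_half, ← norm_neg (1 / 2 : ℚ_[2]), ← mem_closedBall_iff_norm_eq (by norm_num),
    norm_neg, norm_half]
  exact closedBall_subset_closedBall (by norm_num) h

lemma mem_D14_zero_or_one {x : ℚ_[2]} : x ∈ D14 0 ∨ x ∈ D14 1 ↔ ‖x‖ = 2 := by
  refine ⟨fun h => h.elim norm_of_mem_D14_zero norm_of_mem_D14_one, fun h => ?_⟩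
  have h1 : ‖x - 1 / 2‖ ≤ 1 := by
    have := norm_sub_le_half (h.trans norm_half.symm)
    rwa [norm_half, div_self two_ne_zero] at this
  rcases h1.lt_or_eq with h2 | h2
  · left
    have := (norm_lt_iff_le_half (x := x - 1 / 2) (y := 1) one_ne_zero).1 (by simpa using h2)
    simpa [D14, dist_eq_norm] using this
  · right
    have := norm_sub_le_half (x := x - 1 / 2) (y := -1) (by simpa using h2)
    rw [show x - 1 / 2 - -1 = x - -(1 / 2) by ring, norm_neg, norm_one] at this
    simpa [D14, dist_eq_norm] using this

/-- The norm of each point of `D14 i`. -/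
noncomputable def diskNorm : Fin 4 → ℝ := ![2, 2, 1 / 8, 8]

/-- The factor by which `phi a` scales distances on `D14 i`. -/
noncomputable def scale : Fin 4 → ℝ := ![1 / 8, 1 / 8, 64, 1 / 4]

/-- The radius of `D14 i`. -/
noncomputable def radius : Fin 4 → ℝ := ![1 / 2, 1 / 2, 1 / 16, 4]

/-- The center of `D14 i`. -/
noncomputable def center : Fin 4 → ℚ_[2] := ![1 / 2, -(1 / 2), 8, 1 / 8]

lemma D14_eq_closedBall (i : Fin 4) : D14 i = closedBall (center i) (radius i) := by
  fin_cases i <;> rfl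

lemma norm_of_mem_D14 {i : Fin 4} {x : ℚ_[2]} (h : x ∈ D14 i) : ‖x‖ = diskNorm i := by
  fin_cases i
  · exact norm_of_mem_D14_zero h
  · exact norm_of_mem_D14_one h
  · exact mem_D14_two.1 h
  · exact mem_D14_three.1 h

lemma ne_zero_of_mem_D14 {i : Fin 4} {x : ℚ_[2]} (h : x ∈ D14 i) : x ≠ 0 := by
  have hx := norm_of_mem_D14 h
  rintro rfl
  fin_cases i <;> norm_num [diskNorm] at hx

lemma norm_sub_le_radius {i : Fin 4} {x y : ℚ_[2]} (hx : x ∈ D14 i) (hy : y ∈ D14 i) :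
    ‖x - y‖ ≤ radius i := by
  rw [D14_eq_closedBall, mem_closedBall, dist_eq_norm] at hx hy
  rw [← sub_sub_sub_cancel_right x y (center i)]
  exact (norm_sub_le_max _ _).trans (max_le hx hy)

lemma eq_of_mem_D14 {i j : Fin 4} {x : ℚ_[2]} (hi : x ∈ D14 i) (hj : x ∈ D14 j) : i = j := by
  have h01 : x ∈ D14 0 → x ∉ D14 1 := by
    intro h0 h1
    have h0 : ‖x - 1 / 2‖ ≤ 1 / 2 := by simpa [D14, dist_eq_norm] using h0
    have h1 : ‖x - -(1 / 2)‖ ≤ 1 / 2 := by simpa [D14, dist_eq_norm] using h1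
    have h := norm_sub_le_max (x - -(1 / 2)) (x - 1 / 2)
    rw [show x - -(1 / 2) - (x - 1 / 2) = 1 by ring, norm_one] at h
    linarith [h.trans (max_le h1 h0)]
  have h := (norm_of_mem_D14 hi).symm.trans (norm_of_mem_D14 hj)
  fin_cases i <;> fin_cases j <;> first
    | rfl
    | exact absurd hj (h01 hi)
    | exact absurd hi (h01 hj)
    | norm_num [diskNorm] at h

lemma norm_sq_sub_one_le {v : ℚ_[2]} (h : ‖v‖ = 1) : ‖v ^ 2 - 1‖ ≤ 1 / 8 := by
  have h1 := norm_sub_one_le h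
  have h2 : ‖v - -1‖ ≤ 1 / 2 := by simpa using norm_sub_le_half (x := v) (y := -1) (by simpa using h)
  rw [show v ^ 2 - 1 = (v - 1) * (v - -1) by ring, norm_mul]
  rcases h1.lt_or_eq with h3 | h3
  · rw [← norm_two, norm_lt_iff_le_half two_ne_zero, norm_two] at h3
    nlinarith [norm_nonneg (v - 1), norm_nonneg (v - -1)]
  · have h4 := norm_sub_le_half (x := v - 1) (y := -2) (by rw [norm_neg, norm_two, h3])
    rw [show v - 1 - -2 = v - -1 by ring, norm_neg, norm_two] at h4
    nlinarith [norm_nonneg (v - 1), norm_nonneg (v - -1)]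

section Dynamics

variable {a : ℚ_[2]}

lemma norm_mul_sq_add_one (ha : ‖a‖ = 1 / 4) (hsq3 : ∃ c : ℚ_[2], a = 3 * c ^ 2)
    {x : ℚ_[2]} (hx : ‖x‖ = 2) : ‖a * x ^ 2 + 1‖ = 1 / 4 := by
  obtain ⟨c, rfl⟩ := hsq3
  have hv : ‖c * x‖ = 1 := by
    rw [norm_mul, norm_three, norm_pow] at ha
    have : ‖c‖ = 1 / 2 := by nlinarith [norm_nonneg c]
    rw [norm_mul, this, hx]; norm_num
  have h := norm_sq_sub_one_le hv
  rw [show 3 * c ^ 2 * x ^ 2 + 1 = 4 + 3 * ((c * x) ^ 2 - 1) by ring, norm_add_eq_left, norm_four]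
  rw [norm_mul, norm_three, norm_four]
  linarith

lemma norm_phi_of_norm_two (ha : ‖a‖ = 1 / 4) (hsq3 : ∃ c : ℚ_[2], a = 3 * c ^ 2)
    {x : ℚ_[2]} (hx : ‖x‖ = 2) : ‖phi a x‖ = 1 / 8 := by
  have hx0 : x ≠ 0 := by rintro rfl; norm_num at hx
  rw [phi, show a * x + x⁻¹ = (a * x ^ 2 + 1) / x by field_simp, norm_div,
    norm_mul_sq_add_one ha hsq3 hx, hx]
  norm_num

lemma norm_phi_of_norm_eighth (ha : ‖a‖ = 1 / 4) {x : ℚ_[2]} (hx : ‖x‖ = 1 / 8) :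
    ‖phi a x‖ = 8 := by
  rw [phi, add_comm, norm_add_eq_left] <;> norm_num [ha, hx]

lemma norm_phi_of_norm_eight (ha : ‖a‖ = 1 / 4) {x : ℚ_[2]} (hx : ‖x‖ = 8) :
    ‖phi a x‖ = 2 := by
  rw [phi, norm_add_eq_left] <;> norm_num [ha, hx]

lemma phi_sub_phi {x y : ℚ_[2]} (hx : x ≠ 0) (hy : y ≠ 0) :
    phi a x - phi a y = (x - y) * (a - (x * y)⁻¹) := by
  unfold phi; field_simp; ring

lemma norm_slope (ha : ‖a‖ = 1 / 4) (hsq3 : ∃ c : ℚ_[2], a = 3 * c ^ 2) {i : Fin 4}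
    {x y : ℚ_[2]} (hx : x ∈ D14 i) (hy : y ∈ D14 i) : ‖a - (x * y)⁻¹‖ = scale i := by
  have hx0 := ne_zero_of_mem_D14 hx
  have hy0 := ne_zero_of_mem_D14 hy
  have hx' := norm_of_mem_D14 hx
  have hy' := norm_of_mem_D14 hy
  have hxy := norm_sub_le_radius hy hx
  have key : ‖x‖ = 2 → ‖y‖ = 2 → ‖y - x‖ ≤ 1 / 2 → ‖a - (x * y)⁻¹‖ = 1 / 8 := by
    intro hx' hy' hxy
    have h1 : ‖2 * x + (y - x)‖ = 1 := by
      rw [norm_add_eq_left] <;> rw [norm_mul, norm_two, hx'] <;> linarith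
    have h2 : ‖-((2 * x + (y - x)) / (x ^ 2 * y))‖ = 1 / 8 := by
      rw [norm_neg, norm_div, h1, norm_mul, norm_pow, hx', hy']; norm_num
    have h3 : ‖(a * x ^ 2 + 1) / x ^ 2‖ = 1 / 16 := by
      rw [norm_div, norm_mul_sq_add_one ha hsq3 hx', norm_pow, hx']; norm_num
    rw [show a - (x * y)⁻¹ = -((2 * x + (y - x)) / (x ^ 2 * y)) + (a * x ^ 2 + 1) / x ^ 2 by
      field_simp; ring, norm_add_eq_left, h2]
    rw [h2, h3]; norm_num
  fin_cases i
  · exact key hx' hy' hxy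
  · exact key hx' hy' hxy
  · replace hx' : ‖x‖ = 1 / 8 := hx'
    replace hy' : ‖y‖ = 1 / 8 := hy'
    rw [sub_eq_neg_add, norm_add_eq_left] <;> norm_num [ha, hx', hy', scale]
  · replace hx' : ‖x‖ = 8 := hx'
    replace hy' : ‖y‖ = 8 := hy'
    rw [sub_eq_add_neg, norm_add_eq_left] <;> norm_num [ha, hx', hy', scale]

lemma continuousOn_phi (i : Fin 4) : ContinuousOn (phi a) (D14 i) :=
  (continuousOn_const.mul continuousOn_id).add
    (continuousOn_id.inv₀ fun _ h => ne_zero_of_mem_D14 h)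

lemma isCompact_D14 (i : Fin 4) : IsCompact (D14 i) := by
  rw [D14_eq_closedBall]; exact isCompact_closedBall _ _

lemma center_mem_D14 (i : Fin 4) : center i ∈ D14 i := by
  rw [D14_eq_closedBall]
  apply mem_closedBall_self
  fin_cases i <;> norm_num [radius]

lemma scale_pos (i : Fin 4) : 0 < scale i := by
  fin_cases i <;> norm_num [scale]

/-- A point close enough to the image of `D14 i` is in the image: a minimizer of
`‖phi a x - y‖` over the compact disk would otherwise be improved by a Newton step. -/
lemma exists_phi_eq (ha : ‖a‖ = 1 / 4) (hsq3 : ∃ c : ℚ_[2], a = 3 * c ^ 2) {i : Fin 4}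
    {y : ℚ_[2]} (hy : ∀ x ∈ D14 i, ‖phi a x - y‖ ≤ scale i * radius i) :
    ∃ x ∈ D14 i, phi a x = y := by
  obtain ⟨x, hx, hmin⟩ := (isCompact_D14 i).exists_isMinOn ⟨_, center_mem_D14 i⟩
    ((continuousOn_phi (a := a) i).sub (continuousOn_const (c := y))).norm
  refine ⟨x, hx, ?_⟩
  by_contra hne
  have hd : phi a x - y ≠ 0 := sub_ne_zero.2 hne
  set t := a - (x * x)⁻¹ with ht
  have hpos := scale_pos i
  have htn : ‖t‖ = scale i := norm_slope ha hsq3 hx hx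
  have ht0 : t ≠ 0 := norm_pos_iff.1 (htn ▸ hpos)
  set x' := x - (phi a x - y) / t with hx'
  have hx'mem : x' ∈ D14 i := by
    have h1 : ‖x' - x‖ ≤ radius i := by
      rw [hx', sub_sub_cancel_left, norm_neg, norm_div, htn, div_le_iff₀' hpos]
      exact hy x hx
    have h2 := hx
    rw [D14_eq_closedBall, mem_closedBall, dist_eq_norm] at h2 ⊢
    rw [← sub_add_sub_cancel x' x]
    exact (IsUltrametricDist.norm_add_le_max _ _).trans (max_le h1 h2)
  have hs := norm_slope ha hsq3 hx'mem hx
  have hstep : phi a x' - y = -((phi a x - y) / t) * (a - (x' * x)⁻¹ - t) := by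
    have h1 := phi_sub_phi (a := a) (ne_zero_of_mem_D14 hx'mem) (ne_zero_of_mem_D14 hx)
    have h2 : x' - x = -((phi a x - y) / t) := by rw [hx']; ring
    rw [h2] at h1
    rw [mul_sub, ← h1]
    field_simp
    ring
  have hle : ‖phi a x - y‖ ≤ ‖phi a x' - y‖ := hmin hx'mem
  have hhalf := norm_sub_le_half (hs.trans htn.symm)
  rw [hstep, norm_mul, norm_neg, norm_div] at hle
  have hq : ‖phi a x - y‖ / ‖t‖ * ‖a - (x' * x)⁻¹ - t‖ ≤ ‖phi a x - y‖ / ‖t‖ * (‖t‖ / 2) := by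
    gcongr
  have htpos := norm_pos_iff.2 ht0
  rw [show ‖phi a x - y‖ / ‖t‖ * (‖t‖ / 2) = ‖phi a x - y‖ / 2 by field_simp] at hq
  linarith [norm_pos_iff.2 hd]

/-- The disk `D14 i` covers each disk that the incidence matrix allows after it. -/
lemma exists_phi_eq_of_transition (ha : ‖a‖ = 1 / 4) (hsq3 : ∃ c : ℚ_[2], a = 3 * c ^ 2)
    {i j : Fin 4} (hij : A14 i j = 1) {y : ℚ_[2]} (hy : y ∈ D14 j) :
    ∃ x ∈ D14 i, phi a x = y := by
  apply exists_phi_eq ha hsq3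
  intro x hx
  have hx' := norm_of_mem_D14 hx
  have hy' := norm_of_mem_D14 hy
  have h : ‖phi a x‖ = ‖y‖ ∧ ‖y‖ / 2 = scale i * radius i := by
    rw [hy']
    fin_cases i <;> fin_cases j <;> first
      | exact absurd hij (by decide)
      | exact ⟨norm_phi_of_norm_two ha hsq3 hx', by norm_num [diskNorm, scale, radius]⟩
      | exact ⟨norm_phi_of_norm_eighth ha hx', by norm_num [diskNorm, scale, radius]⟩
      | exact ⟨norm_phi_of_norm_eight ha hx', by norm_num [diskNorm, scale, radius]⟩
  exact (norm_sub_le_half h.1).trans_eq h.2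

lemma exists_transition (ha : ‖a‖ = 1 / 4) (hsq3 : ∃ c : ℚ_[2], a = 3 * c ^ 2)
    {i : Fin 4} {x : ℚ_[2]} (hx : x ∈ D14 i) : ∃ j, A14 i j = 1 ∧ phi a x ∈ D14 j := by
  have hx' := norm_of_mem_D14 hx
  fin_cases i
  · exact ⟨2, rfl, mem_D14_two.2 (norm_phi_of_norm_two ha hsq3 hx')⟩
  · exact ⟨2, rfl, mem_D14_two.2 (norm_phi_of_norm_two ha hsq3 hx')⟩
  · exact ⟨3, rfl, mem_D14_three.2 (norm_phi_of_norm_eighth ha hx')⟩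
  · exact (mem_D14_zero_or_one.2 (norm_phi_of_norm_eight ha hx')).elim
      (fun h => ⟨0, rfl, h⟩) (fun h => ⟨1, rfl, h⟩)

/-- Points whose first `n + 1` iterates follow the symbol sequence `s`. -/
def cylinder (a : ℚ_[2]) : ℕ → (ℕ → Fin 4) → Set ℚ_[2]
  | 0, s => D14 (s 0)
  | n + 1, s => D14 (s 0) ∩ phi a ⁻¹' cylinder a n (fun k => s (k + 1))

lemma cylinder_subset (n : ℕ) (s : ℕ → Fin 4) : cylinder a n s ⊆ D14 (s 0) := by
  cases n with
  | zero => exact subset_rfl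
  | succ n => exact inter_subset_left

lemma cylinder_succ_subset (n : ℕ) (s : ℕ → Fin 4) : cylinder a (n + 1) s ⊆ cylinder a n s := by
  induction n generalizing s with
  | zero => exact inter_subset_left
  | succ n ih => exact inter_subset_inter_right _ (preimage_mono (ih _))

lemma isClosed_cylinder (n : ℕ) (s : ℕ → Fin 4) : IsClosed (cylinder a n s) := by
  induction n generalizing s with
  | zero => exact (isCompact_D14 _).isClosed
  | succ n ih =>
    exact (continuousOn_phi _).preimage_isClosed_of_isClosed (isCompact_D14 _).isClosed (ih _)

lemma cylinder_nonempty (ha : ‖a‖ = 1 / 4) (hsq3 : ∃ c : ℚ_[2], a = 3 * c ^ 2) (n : ℕ)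
    (s : ℕ → Fin 4) (hs : ∀ k, A14 (s k) (s (k + 1)) = 1) : (cylinder a n s).Nonempty := by
  induction n generalizing s with
  | zero => exact ⟨_, center_mem_D14 _⟩
  | succ n ih =>
    obtain ⟨y, hy⟩ := ih (fun k => s (k + 1)) (fun k => hs (k + 1))
    obtain ⟨x, hx, rfl⟩ := exists_phi_eq_of_transition ha hsq3 (hs 0) (cylinder_subset _ _ hy)
    exact ⟨x, hx, hy⟩

lemma iterate_mem_of_mem_cylinder (n : ℕ) (s : ℕ → Fin 4) {x : ℚ_[2]}
    (hx : x ∈ cylinder a n s) : (phi a)^[n] x ∈ D14 (s n) := by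
  induction n generalizing s x with
  | zero => exact hx
  | succ n ih => exact ih (fun k => s (k + 1)) hx.2

lemma exists_itinerary (ha : ‖a‖ = 1 / 4) (hsq3 : ∃ c : ℚ_[2], a = 3 * c ^ 2)
    (s : ℕ → Fin 4) (hs : ∀ k, A14 (s k) (s (k + 1)) = 1) :
    ∃ x, ∀ n, (phi a)^[n] x ∈ D14 (s n) := by
  obtain ⟨x, hx⟩ := IsCompact.nonempty_iInter_of_sequence_nonempty_isCompact_isClosed
    (fun n => cylinder a n s) (fun n => cylinder_succ_subset n s)
    (fun n => cylinder_nonempty ha hsq3 n s hs) (isCompact_D14 _)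
    (fun n => isClosed_cylinder n s)
  exact ⟨x, fun n => iterate_mem_of_mem_cylinder n s (mem_iInter.1 hx n)⟩

/-- Weights on the disks for which `phi a` is uniformly expanding. -/
noncomputable def weight : Fin 4 → ℝ := ![1, 1, 10, 1 / 5]

lemma weight_expansion {i j : Fin 4} (hij : A14 i j = 1) :
    5 / 4 * weight i ≤ weight j * scale i := by
  fin_cases i <;> fin_cases j <;> first
    | exact absurd hij (by decide)
    | norm_num [weight, scale]

lemma eq_of_itinerary_eq (ha : ‖a‖ = 1 / 4) (hsq3 : ∃ c : ℚ_[2], a = 3 * c ^ 2)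
    {s : ℕ → Fin 4} (hs : ∀ k, A14 (s k) (s (k + 1)) = 1) {x y : ℚ_[2]}
    (hx : ∀ n, (phi a)^[n] x ∈ D14 (s n)) (hy : ∀ n, (phi a)^[n] y ∈ D14 (s n)) : x = y := by
  have hgrow : ∀ n, (5 / 4 : ℝ) ^ n * (weight (s 0) * ‖x - y‖) ≤
      weight (s n) * ‖(phi a)^[n] x - (phi a)^[n] y‖ := by
    intro n
    induction n with
    | zero => simp
    | succ n ih =>
      rw [Function.iterate_succ_apply', Function.iterate_succ_apply',
        phi_sub_phi (ne_zero_of_mem_D14 (hx n)) (ne_zero_of_mem_D14 (hy n)), norm_mul,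
        norm_slope ha hsq3 (hx n) (hy n), pow_succ']
      have h := mul_le_mul_of_nonneg_right (weight_expansion (hs n))
        (norm_nonneg ((phi a)^[n] x - (phi a)^[n] y))
      linarith
  have hbound : ∀ n, weight (s n) * ‖(phi a)^[n] x - (phi a)^[n] y‖ ≤ 1 := by
    intro n
    have h := norm_sub_le_radius (hx n) (hy n)
    generalize s n = i at h
    fin_cases i <;> norm_num [weight, radius] at h ⊢ <;> linarith
  by_contra hne
  have hpos : 0 < weight (s 0) * ‖x - y‖ := by
    apply mul_pos _ (norm_pos_iff.2 (sub_ne_zero.2 hne))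
    generalize s 0 = i
    fin_cases i <;> norm_num [weight]
  obtain ⟨n, hn⟩ := pow_unbounded_of_one_lt (1 / (weight (s 0) * ‖x - y‖))
    (by norm_num : (1 : ℝ) < 5 / 4)
  rw [div_lt_iff₀ hpos] at hn
  linarith [hgrow n, hbound n]

end Dynamics

theorem stmt_14 (a : ℚ_[2]) (ha0 : a ≠ 0) (ha : ‖a‖ = 1 / 4)
    (hsq3 : ∃ c : ℚ_[2], a = 3 * c ^ 2)
    (Ω : Set ℚ_[2]) (hΩ : Ω = D14 0 ∪ D14 1 ∪ D14 2 ∪ D14 3) :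
    Set.MapsTo (phi a) Ω Ω ∧
    ∃ h : Ω ≃ₜ SigmaA14 A14,
      (∀ (x : Ω) (hx : phi a (x : ℚ_[2]) ∈ Ω),
        ((h ⟨phi a (x : ℚ_[2]), hx⟩ : SigmaA14 A14).1 = fun n => (h x).1 (n + 1))) ∧
      (∀ (x : Ω) (n : ℕ) (j : Fin 4),
        (h x).1 n = j ↔ (phi a)^[n] (x : ℚ_[2]) ∈ D14 j) := by
  have hmem : ∀ x, x ∈ Ω ↔ ∃ i, x ∈ D14 i := by
    intro x
    simp [hΩ, Fin.exists_fin_succ, or_assoc]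
  have hmaps : MapsTo (phi a) Ω Ω := by
    intro x hx
    obtain ⟨i, hi⟩ := (hmem x).1 hx
    obtain ⟨j, -, hj⟩ := exists_transition ha hsq3 hi
    exact (hmem _).2 ⟨j, hj⟩
  refine ⟨hmaps, ?_⟩
  have hiter : ∀ (x : Ω) (n : ℕ), ∃ j, (phi a)^[n] (x : ℚ_[2]) ∈ D14 j :=
    fun x n => (hmem _).1 (hmaps.iterate n x.2)
  choose code hcode using hiter
  have hcode_iff : ∀ (x : Ω) (n : ℕ) (j : Fin 4),
      code x n = j ↔ (phi a)^[n] (x : ℚ_[2]) ∈ D14 j :=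
    fun x n j => ⟨fun h => h ▸ hcode x n, fun h => eq_of_mem_D14 (hcode x n) h⟩
  have hadm : ∀ (x : Ω) (n : ℕ), A14 (code x n) (code x (n + 1)) = 1 := by
    intro x n
    obtain ⟨j, hj, hmj⟩ := exists_transition ha hsq3 (hcode x n)
    rw [← Function.iterate_succ_apply' (phi a)] at hmj
    rwa [(hcode_iff x (n + 1) j).2 hmj]
  have hcont_iter : ∀ n, Continuous fun x : Ω => (phi a)^[n] (x : ℚ_[2]) := by
    have hcont : ContinuousOn (phi a) Ω :=
      (continuousOn_const.mul continuousOn_id).add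
        (continuousOn_id.inv₀ fun x hx => ne_zero_of_mem_D14 ((hmem x).1 hx).choose_spec)
    intro n
    exact continuousOn_iff_continuous_domRestrict.1 (hcont.iterate hmaps n)
  have hcont_code : ∀ n, Continuous fun x : Ω => code x n := by
    intro n
    refine continuous_discrete_rng.2 fun j => ?_
    have hopen : IsOpen (D14 j) := by
      rw [D14_eq_closedBall]
      refine IsUltrametricDist.isOpen_closedBall _ ?_
      fin_cases j <;> norm_num [radius]
    convert hopen.preimage (hcont_iter n) using 1
    ext x
    exact hcode_iff x n j
  let F : Ω → SigmaA14 A14 := fun x => ⟨code x, hadm x⟩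
  have hF : Continuous F := (continuous_pi hcont_code).subtype_mk _
  have hbij : Function.Bijective F := by
    refine ⟨fun x y hxy => ?_, fun s => ?_⟩
    · have hxy' : code x = code y := congrArg Subtype.val hxy
      exact Subtype.ext (eq_of_itinerary_eq ha hsq3 (hadm x) (hcode x) (hxy' ▸ hcode y))
    · obtain ⟨x, hx⟩ := exists_itinerary ha hsq3 s.1 s.2
      refine ⟨⟨x, (hmem x).2 ⟨_, hx 0⟩⟩, Subtype.ext (funext fun n => ?_)⟩
      exact (hcode_iff _ n _).2 (hx n)
  have : CompactSpace Ω := by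
    rw [← isCompact_iff_compactSpace, hΩ]
    exact (((isCompact_D14 0).union (isCompact_D14 1)).union (isCompact_D14 2)).union
      (isCompact_D14 3)
  have : T2Space (SigmaA14 A14) :=
    inferInstanceAs (T2Space {s : ℕ → Fin 4 // ∀ n : ℕ, A14 (s n) (s (n + 1)) = 1})
  refine ⟨hF.homeoOfEquivCompactToT2 (f := Equiv.ofBijective F hbij), fun x hx => ?_, hcode_iff⟩
  funext n
  exact (hcode_iff ⟨phi a x, hx⟩ n _).2 (hcode x (n + 1))
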